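/- Let G be the 2k-player, m-action generalized Matching Pennies game G_{k,m}, let 0 < α and ε = (m−1)/m − α, and let ρ = ((2−α)m − 1)/(2m). In any ε-approximate correlated equilibrium X* of G_{k,m}, for every pair of players (2i−1, 2i) and every pair of actions (j₁, j₂) ∈ [m]², the probability under X* that player 2i−1 plays j₁ and player 2i plays j₂ is at most ρ. -/

import Mathlib

open Finset

noncomputable section

/-- Payoffs of the generalized Matching Pennies game `G_{k,m}`: players are indexed by
    `Fin k × Bool`; for each `i`, player `(i, false)` gets 1 iff she matches `(i, true)`,
    and player `(i, true)` gets 1 iff he mismatches `(i, false)`. -/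
def uMP {k m : ℕ} (v : Fin k × Bool) (a : Fin k × Bool → Fin m) : ℝ :=
  if v.2 = false then (if a (v.1, false) = a (v.1, true) then 1 else 0)
  else (if a (v.1, false) = a (v.1, true) then 0 else 1)

/-- Regret of player `v` under deviation map `φ`, for a correlated strategy `X`. -/
def creg {k m : ℕ} (u : Fin k × Bool → (Fin k × Bool → Fin m) → ℝ)
    (X : (Fin k × Bool → Fin m) → ℝ) (v : Fin k × Bool) (φ : Fin m → Fin m) : ℝ :=
  (∑ a : Fin k × Bool → Fin m, X a * u v (Function.update a v (φ (a v)))) -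
    ∑ a : Fin k × Bool → Fin m, X a * u v a

/-- In any ε-approximate correlated equilibrium of `G_{k,m}` with ε = (m−1)/m − α, the joint
    probability that any Matching-Pennies pair plays any given pair of actions is at most
    ρ = ((2−α)m − 1)/(2m). -/
theorem ACE_pair_prob_bound (k m : ℕ) (hm : 2 ≤ m) (α : ℝ) (hα : 0 < α)
    (X : (Fin k × Bool → Fin m) → ℝ) (hX0 : ∀ a, 0 ≤ X a)
    (hX1 : ∑ a : Fin k × Bool → Fin m, X a = 1)
    (hACE : ∀ v φ, creg uMP X v φ ≤ ((m : ℝ) - 1) / m - α) :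
    ∀ (i : Fin k) (j₁ j₂ : Fin m),
      (∑ a ∈ univ.filter fun a : Fin k × Bool → Fin m =>
          a (i, false) = j₁ ∧ a (i, true) = j₂, X a) ≤ ((2 - α) * m - 1) / (2 * m) := by
  intro i j₁ j₂
  have hm0 : (0 : ℝ) < m := by
    have : 0 < m := by omega
    exact_mod_cast this
  -- a single constant deviation suffices: pointwise gain at least `2 * indicator - 1`
  have key : ∀ (v : Fin k × Bool) (c : Fin m),
      (∀ a : Fin k × Bool → Fin m,
        2 * (if a (i, false) = j₁ ∧ a (i, true) = j₂ then (1 : ℝ) else 0) - 1 ≤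
          uMP v (Function.update a v c) - uMP v a) →
      (∑ a ∈ univ.filter fun a : Fin k × Bool → Fin m =>
          a (i, false) = j₁ ∧ a (i, true) = j₂, X a) ≤ ((2 - α) * m - 1) / (2 * m) := by
    intro v c h
    have h1 := hACE v (fun _ => c)
    have h2 : ∑ a : Fin k × Bool → Fin m,
        X a * (2 * (if a (i, false) = j₁ ∧ a (i, true) = j₂ then (1 : ℝ) else 0) - 1)
        ≤ creg uMP X v (fun _ => c) := by
      unfold creg
      rw [← Finset.sum_sub_distrib]
      refine Finset.sum_le_sum fun a _ => ?_
      rw [← mul_sub]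
      exact mul_le_mul_of_nonneg_left (h a) (hX0 a)
    have h3 : ∑ a : Fin k × Bool → Fin m,
        X a * (2 * (if a (i, false) = j₁ ∧ a (i, true) = j₂ then (1 : ℝ) else 0) - 1)
        = 2 * (∑ a ∈ univ.filter fun a : Fin k × Bool → Fin m =>
          a (i, false) = j₁ ∧ a (i, true) = j₂, X a) - 1 := by
      conv_rhs => rw [← hX1]
      rw [Finset.sum_filter, Finset.mul_sum, ← Finset.sum_sub_distrib]
      refine Finset.sum_congr rfl fun a _ => ?_
      split_ifs <;> ring
    have h4 : ((2 - α) * m - 1) / (2 * m) = (1 + (((m : ℝ) - 1) / m - α)) / 2 := by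
      field_simp
      ring
    rw [h4]
    linarith
  by_cases hj : j₁ = j₂
  · subst hj
    have : Nontrivial (Fin m) := Fin.nontrivial_iff_two_le.mpr hm
    obtain ⟨c, hc⟩ := exists_ne j₁
    refine key (i, true) c fun a => ?_
    have e : Function.update a (i, true) c (i, false) = a (i, false) :=
      Function.update_of_ne (by simp) _ _
    simp only [uMP, e, Function.update_self]
    split_ifs <;> first | (norm_num; done) | grind
  · refine key (i, false) j₂ fun a => ?_
    have e : Function.update a (i, false) j₂ (i, true) = a (i, true) :=
      Function.update_of_ne (by simp) _ _
    simp only [uMP, e, Function.update_self]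
    split_ifs <;> first | (norm_num; done) | grind
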